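/- arXiv:1701.08093 — 2 statements merged into one kernel-verified Lean document; each statement's English description precedes it below -/
import Mathlib

section
/- Let h, p : ℝ² → ℝ be C² with h > 0 everywhere, let Ψ : ℝ → ℝ be three times differentiable, g ∈ ℝ, and define velocity components u, v : ℝ² → ℝ by h·u = −Ψ''(p)·∂_y p and h·v = Ψ''(p)·∂_x p, and kinetic energy E_k = (u² + v²)/2. Assume the gauge-fixing relations hold: (i) E_k + g·h + Ψ(p) − p·Ψ'(p) = 0 at every point, and (ii) ∂_x v − ∂_y u + f = p·h at every point (f ∈ ℝ a constant). Then the steady shallow-water equations hold: (a) ∂_x(h u) + ∂_y(h v) = 0 (mass conservation), and (b) −(p h)·v + ∂_x(E_k + g h) = 0 and (p h)·u + ∂_y(E_k + g h) = 0 (steady momentum balance). -/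
/-- Partial derivative with respect to the first coordinate `x` of a function on `ℝ²`. -/
noncomputable def pdx (f : ℝ × ℝ → ℝ) (q : ℝ × ℝ) : ℝ :=
  deriv (fun s => f (s, q.2)) q.1

/-- Partial derivative with respect to the second coordinate `y` of a function on `ℝ²`. -/
noncomputable def pdy (f : ℝ × ℝ → ℝ) (q : ℝ × ℝ) : ℝ :=
  deriv (fun s => f (q.1, s)) q.2


theorem aux_hx {F : ℝ × ℝ → ℝ} (hF : Differentiable ℝ F) (q : ℝ × ℝ) :
    HasDerivAt (fun s => F (s, q.2)) (fderiv ℝ F q (1, 0)) q.1 := by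
  have h1 : HasDerivAt (fun s : ℝ => (s, q.2)) ((1 : ℝ), (0 : ℝ)) q.1 :=
    (hasDerivAt_id q.1).prodMk (hasDerivAt_const q.1 q.2)
  exact HasFDerivAt.comp_hasDerivAt (l := F) q.1 (hF (q.1, q.2)).hasFDerivAt h1

theorem aux_hy {F : ℝ × ℝ → ℝ} (hF : Differentiable ℝ F) (q : ℝ × ℝ) :
    HasDerivAt (fun s => F (q.1, s)) (fderiv ℝ F q (0, 1)) q.2 := by
  have h1 : HasDerivAt (fun s : ℝ => (q.1, s)) ((0 : ℝ), (1 : ℝ)) q.2 :=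
    (hasDerivAt_const q.2 q.1).prodMk (hasDerivAt_id q.2)
  exact HasFDerivAt.comp_hasDerivAt (l := F) q.2 (hF (q.1, q.2)).hasFDerivAt h1

/-- Let `h, p : ℝ² → ℝ` be C² with `h > 0` everywhere, let `Ψ : ℝ → ℝ` be three
times differentiable, `g ∈ ℝ`, and define velocity components `u, v : ℝ² → ℝ` by
`h·u = −Ψ''(p)·∂_y p` and `h·v = Ψ''(p)·∂_x p`, and kinetic energy `E_k = (u² + v²)/2`.
Assume the gauge-fixing relations hold: (i) `E_k + g·h + Ψ(p) − p·Ψ'(p) = 0` at every point,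
and (ii) `∂_x v − ∂_y u + f = p·h` at every point (`f ∈ ℝ` a constant). Then the steady
shallow-water equations hold: (a) `∂_x(h u) + ∂_y(h v) = 0` (mass conservation), and
(b) `−(p h)·v + ∂_x(E_k + g h) = 0` and `(p h)·u + ∂_y(E_k + g h) = 0`
(steady momentum balance). -/
theorem stmt2 (h p u v : ℝ × ℝ → ℝ) (Ψ : ℝ → ℝ) (g f : ℝ)
    (hh : ContDiff ℝ 2 h) (hp : ContDiff ℝ 2 p) (hpos : ∀ q, 0 < h q)
    (hΨ1 : Differentiable ℝ Ψ) (hΨ2 : Differentiable ℝ (deriv Ψ))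
    (hΨ3 : Differentiable ℝ (deriv (deriv Ψ)))
    (hu : ∀ q, h q * u q = -(deriv (deriv Ψ) (p q)) * pdy p q)
    (hv : ∀ q, h q * v q = deriv (deriv Ψ) (p q) * pdx p q)
    (hgauge : ∀ q, (u q ^ 2 + v q ^ 2) / 2 + g * h q + Ψ (p q) - p q * deriv Ψ (p q) = 0)
    (hvort : ∀ q, pdx v q - pdy u q + f = p q * h q) :
    (∀ q, pdx (fun r => h r * u r) q + pdy (fun r => h r * v r) q = 0) ∧
    (∀ q, -(p q * h q) * v q
        + pdx (fun r => (u r ^ 2 + v r ^ 2) / 2 + g * h r) q = 0) ∧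
    (∀ q, (p q * h q) * u q
        + pdy (fun r => (u r ^ 2 + v r ^ 2) / 2 + g * h r) q = 0) := by
  have dp : Differentiable ℝ p := hp.differentiable (by norm_num)
  have d2 : Differentiable ℝ (fderiv ℝ p) :=
    (hp.fderiv_right (m := 1) (by norm_num)).differentiable (by norm_num)
  have ex : ∀ q, pdx p q = fderiv ℝ p q (1, 0) := fun q => (aux_hx dp q).deriv
  have ey : ∀ q, pdy p q = fderiv ℝ p q (0, 1) := fun q => (aux_hy dp q).deriv
  have eE : (fun r => (u r ^ 2 + v r ^ 2) / 2 + g * h r)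
      = fun r => p r * deriv Ψ (p r) - Ψ (p r) := by
    funext r
    linarith [hgauge r]
  refine ⟨fun q => ?_, fun q => ?_, fun q => ?_⟩
  · have e1 : (fun r => h r * u r)
        = fun r => -(deriv (deriv Ψ) (p r)) * fderiv ℝ p r (0, 1) := by
      funext r
      rw [hu, ey]
    have e2 : (fun r => h r * v r)
        = fun r => deriv (deriv Ψ) (p r) * fderiv ℝ p r (1, 0) := by
      funext r
      rw [hv, ex]
    have dd : ∀ w : ℝ × ℝ, ∀ z, fderiv ℝ (fun r => fderiv ℝ p r w) q z
        = fderiv ℝ (fderiv ℝ p) q z w := by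
      intro w z
      rw [fderiv_clm_apply (d2 q) (differentiableAt_const w)]
      simp
    have hs : fderiv ℝ (fderiv ℝ p) q (1, 0) (0, 1) = fderiv ℝ (fderiv ℝ p) q (0, 1) (1, 0) :=
      (hp.contDiffAt (x := q)).isSymmSndFDerivAt (by simp) (1, 0) (0, 1)
    have a1 := aux_hx (F := fun r => fderiv ℝ p r (0, 1))
      (d2.clm_apply (differentiable_const _)) q
    have a2 := aux_hy (F := fun r => fderiv ℝ p r (1, 0))
      (d2.clm_apply (differentiable_const _)) q
    rw [dd] at a1 a2
    have b1 := HasDerivAt.comp q.1 (hΨ3 (p q)).hasDerivAt (aux_hx dp q)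
    have b2 := HasDerivAt.comp q.2 (hΨ3 (p q)).hasDerivAt (aux_hy dp q)
    have c1 := (b1.neg.mul a1).deriv
    have c2 := (b2.mul a2).deriv
    rw [e1, e2]
    change deriv (fun s => -(deriv (deriv Ψ) (p (s, q.2))) * fderiv ℝ p (s, q.2) (0, 1)) q.1
      + deriv (fun s => deriv (deriv Ψ) (p (q.1, s)) * fderiv ℝ p (q.1, s) (1, 0)) q.2 = 0
    refine (congrArg₂ (· + ·) c1 c2).trans ?_
    simp only [Function.comp, Pi.neg_apply, Prod.mk.eta, hs]
    ring
  · have a := aux_hx dp q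
    have b1 := HasDerivAt.comp q.1 (hΨ2 (p q)).hasDerivAt a
    have b2 := HasDerivAt.comp q.1 (hΨ1 (p q)).hasDerivAt a
    have c := ((a.mul b1).sub b2).deriv
    rw [eE]
    have c' : pdx (fun r => p r * deriv Ψ (p r) - Ψ (p r)) q = _ := c
    rw [c']
    have := hv q
    rw [ex] at this
    simp only [Function.comp, Prod.mk.eta]
    linear_combination -(p q) * this
  · have a := aux_hy dp q
    have b1 := HasDerivAt.comp q.2 (hΨ2 (p q)).hasDerivAt a
    have b2 := HasDerivAt.comp q.2 (hΨ1 (p q)).hasDerivAt a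
    have c := ((a.mul b1).sub b2).deriv
    rw [eE]
    have c' : pdy (fun r => p r * deriv Ψ (p r) - Ψ (p r)) q = _ := c
    rw [c']
    have := hu q
    rw [ey] at this
    simp only [Function.comp, Prod.mk.eta]
    linear_combination (p q) * this
end

section
/- (Apedic theorem, coordinate form.) Let U ⊆ ℝ³ be open with coordinates (b,p,t). Let Z, Ω^b, Ω^p, Ω^t : U → ℝ be C¹, and let Ψ̄ : ℝ² → ℝ be a C² function of (b,p) only. Assume: (i) closedness of the vorticity two-form, ∂_b Ω^b + ∂_p Ω^p + ∂_t Ω^t = 0 on U; (ii) ∂_b Ψ̄(b,p) = −(Z(b,p,t) + Ω^p(b,p,t)) on U; (iii) ∂_p Ψ̄(b,p) = Ω^b(b,p,t) on U. Then the following are equivalent on U: (a) ∂_t Z = 0 and ∂_p Z = 0 (the state is apedic, i.e. Z depends on b alone); (b) ∂_t Ω^p = 0 and ∂_t Ω^t = 0. -/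
/-- Partial derivative with respect to `b` of a function on `ℝ³` (arguments `(b,p,t)`). -/
noncomputable def pdb (f : ℝ × ℝ × ℝ → ℝ) (q : ℝ × ℝ × ℝ) : ℝ :=
  deriv (fun s => f (s, q.2)) q.1

/-- Partial derivative with respect to `p` of a function on `ℝ³` (arguments `(b,p,t)`). -/
noncomputable def pdp (f : ℝ × ℝ × ℝ → ℝ) (q : ℝ × ℝ × ℝ) : ℝ :=
  deriv (fun s => f (q.1, s, q.2.2)) q.2.1

/-- Partial derivative with respect to `t` of a function on `ℝ³` (arguments `(b,p,t)`). -/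
noncomputable def pdt (f : ℝ × ℝ × ℝ → ℝ) (q : ℝ × ℝ × ℝ) : ℝ :=
  deriv (fun s => f (q.1, q.2.1, s)) q.2.2

/-- Partial derivative with respect to `b` of a function on `ℝ²` (arguments `(b,p)`). -/
noncomputable def pdb2 (f : ℝ × ℝ → ℝ) (q : ℝ × ℝ) : ℝ :=
  deriv (fun s => f (s, q.2)) q.1

/-- Partial derivative with respect to `p` of a function on `ℝ²` (arguments `(b,p)`). -/
noncomputable def pdp2 (f : ℝ × ℝ → ℝ) (q : ℝ × ℝ) : ℝ :=
  deriv (fun s => f (q.1, s)) q.2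

theorem pdb2_eq_fderiv (f : ℝ × ℝ → ℝ) (hf : Differentiable ℝ f) (x : ℝ × ℝ) :
    pdb2 f x = fderiv ℝ f x (1, 0) := by
  have h1 : HasDerivAt (fun s : ℝ => (s, x.2)) ((1 : ℝ), (0 : ℝ)) x.1 :=
    (hasDerivAt_id x.1).prodMk (hasDerivAt_const _ _)
  have h2 : HasFDerivAt f (fderiv ℝ f x) (x.1, x.2) := (hf x).hasFDerivAt
  exact (h2.comp_hasDerivAt x.1 h1).deriv

theorem pdp2_eq_fderiv (f : ℝ × ℝ → ℝ) (hf : Differentiable ℝ f) (x : ℝ × ℝ) :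
    pdp2 f x = fderiv ℝ f x (0, 1) := by
  have h1 : HasDerivAt (fun s : ℝ => (x.1, s)) ((0 : ℝ), (1 : ℝ)) x.2 :=
    (hasDerivAt_const _ _).prodMk (hasDerivAt_id x.2)
  have h2 : HasFDerivAt f (fderiv ℝ f x) (x.1, x.2) := (hf x).hasFDerivAt
  exact (h2.comp_hasDerivAt x.2 h1).deriv

theorem mixed_partials (f : ℝ × ℝ → ℝ) (hf : ContDiff ℝ 2 f) (b p : ℝ) :
    deriv (fun s => pdp2 f (s, p)) b = deriv (fun s => pdb2 f (b, s)) p := by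
  have hd : Differentiable ℝ f := hf.differentiable (by norm_num)
  have hd2 : Differentiable ℝ (fderiv ℝ f) :=
    (hf.fderiv_right (m := 1) (by norm_num)).differentiable (by norm_num)
  have hs : IsSymmSndFDerivAt ℝ f (b, p) :=
    hf.contDiffAt.isSymmSndFDerivAt (by simp)
  simp only [pdp2_eq_fderiv f hd, pdb2_eq_fderiv f hd]
  have h := (hd2 (b, p)).hasFDerivAt
  have h1 : HasDerivAt (fun s : ℝ => (s, p)) ((1 : ℝ), (0 : ℝ)) b :=
    (hasDerivAt_id b).prodMk (hasDerivAt_const _ _)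
  have h2 : HasDerivAt (fun s : ℝ => (b, s)) ((0 : ℝ), (1 : ℝ)) p :=
    (hasDerivAt_const _ _).prodMk (hasDerivAt_id p)
  have e1 : HasDerivAt (fun s : ℝ => fderiv ℝ f (s, p)) (fderiv ℝ (fderiv ℝ f) (b, p) (1, 0)) b :=
    h.comp_hasDerivAt b h1
  have e2 : HasDerivAt (fun s : ℝ => fderiv ℝ f (b, s)) (fderiv ℝ (fderiv ℝ f) (b, p) (0, 1)) p :=
    h.comp_hasDerivAt p h2
  have e1' : HasDerivAt (fun s : ℝ => fderiv ℝ f (s, p) (0, 1))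
      (fderiv ℝ (fderiv ℝ f) (b, p) (1, 0) (0, 1)) b := by
    simpa using e1.clm_apply (hasDerivAt_const b ((0 : ℝ), (1 : ℝ)))
  have e2' : HasDerivAt (fun s : ℝ => fderiv ℝ f (b, s) (1, 0))
      (fderiv ℝ (fderiv ℝ f) (b, p) (0, 1) (1, 0)) p := by
    simpa using e2.clm_apply (hasDerivAt_const p ((1 : ℝ), (0 : ℝ)))
  rw [e1'.deriv, e2'.deriv]
  exact hs.eq _ _

/-- Apedic theorem, coordinate form: Let `U ⊆ ℝ³` be open with coordinates
`(b,p,t)`. Let `Z, Ω^b, Ω^p, Ω^t : U → ℝ` be C¹, and let `Ψ̄ : ℝ² → ℝ` be a C² function of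
`(b,p)` only. Assume: (i) closedness of the vorticity two-form,
`∂_b Ω^b + ∂_p Ω^p + ∂_t Ω^t = 0` on `U`; (ii) `∂_b Ψ̄(b,p) = −(Z(b,p,t) + Ω^p(b,p,t))` on
`U`; (iii) `∂_p Ψ̄(b,p) = Ω^b(b,p,t)` on `U`. Then the following are equivalent on `U`:
(a) `∂_t Z = 0` and `∂_p Z = 0` (the state is apedic, i.e. `Z` depends on `b` alone);
(b) `∂_t Ω^p = 0` and `∂_t Ω^t = 0`. -/
theorem stmt7 (U : Set (ℝ × ℝ × ℝ)) (hU : IsOpen U)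
    (Z Ωb Ωp Ωt : ℝ × ℝ × ℝ → ℝ) (Ψbar : ℝ × ℝ → ℝ)
    (hZ : ContDiffOn ℝ 1 Z U) (hΩb : ContDiffOn ℝ 1 Ωb U)
    (hΩp : ContDiffOn ℝ 1 Ωp U) (hΩt : ContDiffOn ℝ 1 Ωt U)
    (hΨbar : ContDiff ℝ 2 Ψbar)
    (hclosed : ∀ q ∈ U, pdb Ωb q + pdp Ωp q + pdt Ωt q = 0)
    (hii : ∀ q ∈ U, pdb2 Ψbar (q.1, q.2.1) = -(Z q + Ωp q))
    (hiii : ∀ q ∈ U, pdp2 Ψbar (q.1, q.2.1) = Ωb q) :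
    (∀ q ∈ U, pdt Z q = 0 ∧ pdp Z q = 0) ↔ (∀ q ∈ U, pdt Ωp q = 0 ∧ pdt Ωt q = 0) := by
  have key : ∀ q ∈ U, pdt Z q = - pdt Ωp q ∧ pdt Ωt q = pdp Z q := by
    rintro ⟨b, p, t⟩ hq
    have hn : U ∈ nhds (b, p, t) := hU.mem_nhds hq
    have dZ : DifferentiableAt ℝ Z (b, p, t) :=
      (hZ.contDiffAt hn).differentiableAt (by norm_num)
    have dP : DifferentiableAt ℝ Ωp (b, p, t) :=
      (hΩp.contDiffAt hn).differentiableAt (by norm_num)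
    have cb : ContinuousAt (fun s : ℝ => (s, p, t)) b := by fun_prop
    have cp : ContinuousAt (fun s : ℝ => (b, s, t)) p := by fun_prop
    have ct : ContinuousAt (fun s : ℝ => (b, p, s)) t := by fun_prop
    have ub : ∀ᶠ s in nhds b, (s, p, t) ∈ U := cb hn
    have up : ∀ᶠ s in nhds p, (b, s, t) ∈ U := cp hn
    have ut : ∀ᶠ s in nhds t, (b, p, s) ∈ U := ct hn
    have zt : DifferentiableAt ℝ (fun s : ℝ => Z (b, p, s)) t :=
      DifferentiableAt.comp (g := Z) t dZ (by fun_prop)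
    have zp : DifferentiableAt ℝ (fun s : ℝ => Z (b, s, t)) p :=
      DifferentiableAt.comp (g := Z) p dZ (by fun_prop)
    have wp : DifferentiableAt ℝ (fun s : ℝ => Ωp (b, s, t)) p :=
      DifferentiableAt.comp (g := Ωp) p dP (by fun_prop)
    constructor
    · have e : (fun s : ℝ => Z (b, p, s)) =ᶠ[nhds t]
          fun s => - pdb2 Ψbar (b, p) - Ωp (b, p, s) := by
        filter_upwards [ut] with s hs
        have := hii _ hs
        simp only at this
        linarith
      have := e.deriv_eq
      rw [deriv_const_sub] at this
      exact this
    · have e1 : (fun s : ℝ => pdp2 Ψbar (s, p)) =ᶠ[nhds b] fun s => Ωb (s, p, t) := by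
        filter_upwards [ub] with s hs
        exact hiii _ hs
      have e2 : (fun s : ℝ => pdb2 Ψbar (b, s)) =ᶠ[nhds p]
          fun s => -(Z (b, s, t) + Ωp (b, s, t)) := by
        filter_upwards [up] with s hs
        exact hii _ hs
      have m := mixed_partials Ψbar hΨbar b p
      rw [e1.deriv_eq, e2.deriv_eq, deriv.fun_neg, deriv_fun_add zp wp] at m
      have c := hclosed _ hq
      simp only [pdb, pdp, pdt] at c ⊢
      linarith
  constructor
  · intro h q hq
    obtain ⟨k1, k2⟩ := key q hq
    obtain ⟨h1, h2⟩ := h q hq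
    constructor <;> linarith
  · intro h q hq
    obtain ⟨k1, k2⟩ := key q hq
    obtain ⟨h1, h2⟩ := h q hq
    constructor <;> linarith
end
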